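/- Let k be a field, let A be a commutative k-algebra, and let n ≥ 3 be an integer. Let a₁, …, a_n ∈ A and let b_{ij} ∈ A for 1 ≤ i < j ≤ n be elements satisfying the Plücker-type relations a_i·b_{jl} − a_j·b_{il} + a_l·b_{ij} = 0 for all 1 ≤ i < j < l ≤ n. Viewing A as a k-vector space, let d : Λ^{n−2} A ⊗ A → Λ^{n−3} A ⊗ A be the Koszul differential twisted by the multiplication of A, i.e. d((x₁ ∧ ⋯ ∧ x_{n−2}) ⊗ y) = Σ_m (−1)^{m+1} (x₁ ∧ ⋯ ∧ x_{m−1} ∧ x_{m+1} ∧ ⋯ ∧ x_{n−2}) ⊗ (y · x_m). Then d(Σ_{i<j} (−1)^{i+j} (a₁ ∧ ⋯ ∧ â_i ∧ ⋯ ∧ â_j ∧ ⋯ ∧ a_n) ⊗ b_{ij}) = 0, where â_i means that the factor a_i is omitted. (This is the algebraic content of point (i) in Section 7: the composition δ ∘ φ vanishes, where φ(v^k) = Σ_{i<j} (−1)^{i+j} (v⋏w₁) ∧ ⋯ ∧ (v⋏w_i)^ ∧ ⋯ ∧ (v⋏w_j)^ ∧ ⋯ ∧ (v⋏w_{k+1})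 ⊗ (w_i⋏w_j); here a_i = v⋏w_i, b_{ij} = w_i⋏w_j, and the relations a_i b_{jl} − a_j b_{il} + a_l b_{ij} = 0 follow from the rank 2 Plücker identity.) -/

import Mathlib

open scoped TensorProduct

/-- The canonical alternating product `v₁ ∧ ⋯ ∧ vₙ`, as an element of the `n`-th exterior
power `⋀[R]^n M` (viewed as a submodule of the exterior algebra). -/
noncomputable def ιMulti' (R : Type*) [CommRing R] {M : Type*} [AddCommGroup M] [Module R M]
    (n : ℕ) (v : Fin n → M) : ⋀[R]^n M :=
  ⟨ExteriorAlgebra.ιMulti R n v, ExteriorAlgebra.ιMulti_range R n (Set.mem_range_self _)⟩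

/-- The family `v` with its `i`-th entry removed. -/
def removeAt {V : Type*} {p : ℕ} (v : Fin p → V) (i : Fin p) : Fin (p - 1) → V :=
  fun j => v ⟨if (j : ℕ) < (i : ℕ) then (j : ℕ) else (j : ℕ) + 1, by
    have hj := j.isLt; have hi := i.isLt; split <;> omega⟩

set_option synthInstance.maxHeartbeats 1000000

theorem removeAt_eq_comp_succAbove {V : Type*} {p : ℕ} (v : Fin (p + 1) → V) (i : Fin (p + 1)) :
    removeAt v i = v ∘ i.succAbove := by
  funext x
  simp only [removeAt, Function.comp_apply]
  congr 1
  ext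
  simp only [Fin.succAbove, Fin.lt_def, Fin.val_castSucc]
  split <;> simp

/-- The alternating product of the entries of `v` with index outside `S`, in increasing order,
with junk value `0` when there are not exactly `p` such indices. -/
noncomputable def wedgeCompl (R : Type*) [CommRing R] {M : Type*} [AddCommGroup M] [Module R M]
    {q : ℕ} (p : ℕ) (v : Fin q → M) (S : Finset (Fin q)) : ⋀[R]^p M :=
  if h : Sᶜ.card = p then ιMulti' R p (v ∘ Sᶜ.orderEmbOfFin h) else 0

theorem ιMulti'_comp_eq_wedgeCompl (R : Type*) [CommRing R] {M : Type*} [AddCommGroup M]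
    [Module R M] {p q : ℕ} (v : Fin q → M) (S : Finset (Fin q)) (hS : Sᶜ.card = p)
    (f : Fin p → Fin q) (hf : StrictMono f) (hfS : ∀ x, f x ∉ S) :
    ιMulti' R p (v ∘ f) = wedgeCompl R p v S := by
  rw [wedgeCompl, dif_pos hS,
    Finset.orderEmbOfFin_unique hS (fun x => Finset.mem_compl.2 (hfS x)) hf]

theorem ιMulti'_succAbove_eq_wedgeCompl (R : Type*) [CommRing R] {M : Type*} [AddCommGroup M]
    [Module R M] {p : ℕ} (v : Fin (p + 3) → M) (j : Fin (p + 3)) (i : Fin (p + 2))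
    (m : Fin (p + 1)) :
    ιMulti' R p (((v ∘ j.succAbove) ∘ i.succAbove) ∘ m.succAbove) =
      wedgeCompl R p v {j.succAbove i, j, j.succAbove (i.succAbove m)} := by
  refine ιMulti'_comp_eq_wedgeCompl R v _ ?_ (j.succAbove ∘ i.succAbove ∘ m.succAbove)
    ((Fin.strictMono_succAbove j).comp
      ((Fin.strictMono_succAbove i).comp (Fin.strictMono_succAbove m))) ?_
  · rw [Finset.card_compl, Finset.card_eq_three.2 ⟨_, _, _, Fin.succAbove_ne j i, ?_,
      (Fin.succAbove_ne j _).symm, rfl⟩, Fintype.card_fin, Nat.add_sub_cancel]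
    exact fun h => Fin.succAbove_ne i m (Fin.succAbove_right_injective h).symm
  · intro x
    simp [Fin.succAbove_right_injective.eq_iff, Fin.succAbove_ne]

theorem neg_one_pow_succAbove_succAbove (R : Type*) [CommRing R] {p : ℕ} (j : Fin (p + 3))
    (i : Fin (p + 2)) (m : Fin (p + 1)) (hij : j.succAbove i < j) :
    (-1 : R) ^ ((j.succAbove i : ℕ) + j) * (-1) ^ (m : ℕ) =
      (if j.succAbove i < j.succAbove (i.succAbove m) ∧ j.succAbove (i.succAbove m) < j
        then -1 else 1) *
        (-1) ^ ((j.succAbove i : ℕ) + j + (j.succAbove (i.succAbove m) : ℕ)) := by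
  have key : ((m : ℕ) = j.succAbove (i.succAbove m) ∧ j.succAbove (i.succAbove m) < j.succAbove i) ∨
      ((m : ℕ) + 1 = j.succAbove (i.succAbove m) ∧ j.succAbove i < j.succAbove (i.succAbove m) ∧
        j.succAbove (i.succAbove m) < j) ∨
      ((m : ℕ) + 2 = j.succAbove (i.succAbove m) ∧ j < j.succAbove (i.succAbove m)) := by
    simp only [Fin.succAbove, Fin.lt_def, Fin.val_castSucc] at hij ⊢
    split_ifs at hij ⊢ <;> simp_all <;> omega
  rcases key with ⟨h, h'⟩ | ⟨h, h'⟩ | ⟨h, h'⟩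
  · rw [if_neg fun c => lt_asymm c.1 h', ← h]; ring
  · rw [if_pos h', ← h]; ring
  · rw [if_neg fun c => lt_asymm c.2 h', ← h]; ring

/-- Summing over all choices of an ordered pair and a further index amounts to summing over all
increasing triples. -/
theorem sum_pair_index_eq_sum_triple {E : Type*} [AddCommMonoid E] {q : ℕ}
    (F : Fin q → Fin q → Fin q → E) :
    ∑ i, ∑ j, ∑ l, (if i < j ∧ l ≠ i ∧ l ≠ j then F i j l else 0) =
      ∑ i, ∑ j, ∑ l, (if i < j ∧ j < l then F i j l + F i l j + F j l i else 0) := by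
  have hsplit : ∀ i j l : Fin q, (if i < j ∧ l ≠ i ∧ l ≠ j then F i j l else 0) =
      (if i < j ∧ j < l then F i j l else 0) + (if i < l ∧ l < j then F i j l else 0) +
        (if l < i ∧ i < j then F i j l else 0) := by
    intro i j l
    by_cases h : i < j ∧ l ≠ i ∧ l ≠ j
    · rw [if_pos h]
      obtain ⟨hij, hli, hlj⟩ := h
      rcases lt_or_gt_of_ne hli with h1 | h1
      · simp [h1, hij, h1.not_gt, (h1.trans hij).not_gt]
      · rcases lt_or_gt_of_ne hlj with h2 | h2
        · simp [h1, h2, h1.not_gt, h2.not_gt]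
        · simp [h1.not_gt, h2.not_gt, hij, h2]
    · rw [if_neg h, if_neg, if_neg, if_neg] 
      · simp
      all_goals exact fun c => h (by grind)
  have e2 : ∑ i, ∑ j, ∑ l, (if i < l ∧ l < j then F i j l else 0) =
      ∑ i, ∑ j, ∑ l, (if i < j ∧ j < l then F i l j else 0) :=
    Finset.sum_congr rfl fun i _ => Finset.sum_comm
  have e3 : ∑ i, ∑ j, ∑ l, (if l < i ∧ i < j then F i j l else 0) =
      ∑ i, ∑ j, ∑ l, (if i < j ∧ j < l then F j l i else 0) := by
    rw [Finset.sum_comm' (t' := Finset.univ) (s' := fun _ => Finset.univ) (by simp)]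
    rw [Finset.sum_congr rfl fun j _ => Finset.sum_comm, Finset.sum_comm]
    exact Finset.sum_congr rfl fun i _ => Finset.sum_comm
  simp only [hsplit, Finset.sum_add_distrib, e2, e3]
  simp only [← Finset.sum_add_distrib]
  refine Finset.sum_congr rfl fun i _ => Finset.sum_congr rfl fun j _ =>
    Finset.sum_congr rfl fun l _ => ?_
  split_ifs <;> simp

/-- Let `k` be a field, `A` a commutative `k`-algebra, `n ≥ 3` an integer. Let
`a₁, …, a_n ∈ A` and `b_{ij} ∈ A` (for `i < j`) satisfy the Plücker-type relations
`a_i b_{jl} − a_j b_{il} + a_l b_{ij} = 0` for all `i < j < l`. Let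
`d : Λ^{n−2} A ⊗ A → Λ^{n−3} A ⊗ A` be the Koszul differential twisted by the
multiplication of `A`, determined by
`d((x₁ ∧ ⋯ ∧ x_{n−2}) ⊗ y) = Σₘ (−1)^{m+1} (x₁ ∧ ⋯ ∧ x̂ₘ ∧ ⋯ ∧ x_{n−2}) ⊗ (y·xₘ)`.
Then `d(Σ_{i<j} (−1)^{i+j} (a₁ ∧ ⋯ ∧ âᵢ ∧ ⋯ ∧ âⱼ ∧ ⋯ ∧ a_n) ⊗ b_{ij}) = 0`. -/
theorem twisted_koszul_vanishing
    (k A : Type*) [Field k] [CommRing A] [Algebra k A]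
    (n : ℕ) (hn : 3 ≤ n)
    (a : Fin n → A) (b : Fin n → Fin n → A)
    (hb : ∀ i j l : Fin n, (i : ℕ) < (j : ℕ) → (j : ℕ) < (l : ℕ) →
      a i * b j l - a j * b i l + a l * b i j = 0)
    (d : ((⋀[k]^(n - 2) A) ⊗[k] A) →ₗ[k] ((⋀[k]^(n - 3) A) ⊗[k] A))
    (hd : ∀ (x : Fin (n - 2) → A) (y : A),
      d ((ιMulti' k (n - 2) x) ⊗ₜ[k] y)
        = ∑ m : Fin (n - 2),
            ((-1 : k) ^ (m : ℕ)) • ((ιMulti' k (n - 3) (removeAt x m)) ⊗ₜ[k] (y * x m))) :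
    d (∑ i : Fin n, ∑ j : Fin n,
        if h : (i : ℕ) < (j : ℕ) then
          ((-1 : k) ^ ((i : ℕ) + (j : ℕ))) •
            ((ιMulti' k (n - 2)
                (removeAt (removeAt a j) ⟨(i : ℕ), by have := j.isLt; show (i : ℕ) < n - 1; omega⟩))
              ⊗ₜ[k] b i j)
        else 0) = 0 := by
  obtain ⟨p, rfl⟩ : ∃ p, n = p + 3 := ⟨n - 3, by omega⟩
  let F : Fin (p + 3) → Fin (p + 3) → Fin (p + 3) → (⋀[k]^p A) ⊗[k] A := fun i j l =>
    ((if i < l ∧ l < j then -1 else 1) * (-1 : k) ^ ((i : ℕ) + j + l)) •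
      (wedgeCompl k p a {i, j, l} ⊗ₜ[k] (b i j * a l))
  have hterm : ∀ i j : Fin (p + 3),
      d (if h : (i : ℕ) < (j : ℕ) then
          ((-1 : k) ^ ((i : ℕ) + (j : ℕ))) •
            ((ιMulti' k (p + 3 - 2)
                (removeAt (removeAt a j) ⟨(i : ℕ), by have := j.isLt; show (i : ℕ) < p + 3 - 1; omega⟩))
              ⊗ₜ[k] b i j)
        else 0) = ∑ l, (if i < j ∧ l ≠ i ∧ l ≠ j then F i j l else 0) := by
    intro i j
    by_cases hij : i < j
    swap
    · rw [dif_neg (Fin.lt_def.not.1 hij), map_zero]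
      simp [hij]
    have hip : (i : ℕ) < p + 2 := by omega
    obtain ⟨i', hi', rfl⟩ : ∃ i' : Fin (p + 2), i' = ⟨i, hip⟩ ∧ j.succAbove i' = i :=
      ⟨⟨i, hip⟩, rfl, Fin.succAbove_of_castSucc_lt _ _ hij⟩
    rw [dif_pos (Fin.lt_def.1 hij), map_smul, hd, Finset.smul_sum, Fin.sum_univ_succAbove _ j,
      Fin.sum_univ_succAbove _ i']
    simp only [ne_eq, not_true_eq_false, and_false, false_and, if_false, zero_add]
    refine Finset.sum_congr rfl fun m _ => ?_
    have hne : j.succAbove (i'.succAbove m) ≠ j.succAbove i' := fun h =>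
      Fin.succAbove_ne i' m (Fin.succAbove_right_injective h)
    rw [if_pos ⟨hij, hne, Fin.succAbove_ne j _⟩, smul_smul,
      neg_one_pow_succAbove_succAbove k j i' m hij]
    have hr : removeAt (removeAt a j) ⟨(j.succAbove i' : ℕ), hip⟩ =
        (a ∘ j.succAbove) ∘ i'.succAbove := by
      rw [← hi', removeAt_eq_comp_succAbove a j]
      exact removeAt_eq_comp_succAbove (p := p + 1) _ i'
    have hw := ιMulti'_succAbove_eq_wedgeCompl k a j i' m
    rw [← removeAt_eq_comp_succAbove (p := p) ((a ∘ j.succAbove) ∘ i'.succAbove) m, ← hr] at hw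
    have ha : removeAt (removeAt a j) ⟨(j.succAbove i' : ℕ), hip⟩ m =
        a (j.succAbove (i'.succAbove m)) := congrFun hr m
    exact congrArg₂ (fun w y => _ • (w ⊗ₜ[k] (b (j.succAbove i') j * y))) hw ha
  simp only [map_sum]
  rw [Finset.sum_congr rfl fun i _ => Finset.sum_congr rfl fun j _ => hterm i j,
    sum_pair_index_eq_sum_triple]
  refine Finset.sum_eq_zero fun i _ => Finset.sum_eq_zero fun j _ =>
    Finset.sum_eq_zero fun l _ => ?_
  split_ifs with h
  swap
  · rfl
  obtain ⟨hij, hjl⟩ := h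
  have s1 : ({i, l, j} : Finset (Fin (p + 3))) = {i, j, l} := by
    ext; simp; tauto
  have s2 : ({j, l, i} : Finset (Fin (p + 3))) = {i, j, l} := by
    ext; simp; tauto
  have p1 : (i : ℕ) + l + j = i + j + l := by ring
  have p2 : (j : ℕ) + l + i = i + j + l := by ring
  simp only [F, s1, s2, p1, p2, hij, hjl, hjl.not_gt, hij.not_gt, and_false,
    false_and, and_self, if_true, if_false, one_mul, neg_one_mul]
  rw [← TensorProduct.tmul_smul, ← TensorProduct.tmul_smul, ← TensorProduct.tmul_smul,
    ← TensorProduct.tmul_add, ← TensorProduct.tmul_add, neg_smul, ← sub_eq_add_neg, ← smul_sub,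
    ← smul_add]
  have hz : b i j * a l - b i l * a j + b j l * a i = 0 := by
    rw [← hb i j l hij hjl]; ring
  rw [hz, smul_zero, TensorProduct.tmul_zero]
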